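/- The Euler numbers E_n (number of alternating permutations of [n]) satisfy: the shifted sequence (E_{n+1})_{n≥0} = (1, 2, 5, 16, 61, 272, ...) is 2-log-convex; that is, E_n E_{n+2} ≥ E_{n+1}² for all n ≥ 1, and (E_n E_{n+2} − E_{n+1}²)(E_{n+2}E_{n+4} − E_{n+3}²) ≥ (E_{n+1}E_{n+3} − E_{n+2}²)² for all n ≥ 1. -/

import Mathlib

/-- A permutation `π` of `Fin n` is alternating if `π(1) > π(2) < π(3) > π(4) < ⋯`
(here with `0`-based indexing: descents at even positions, ascents at odd ones). -/
def IsAlternating {n : ℕ} (π : Equiv.Perm (Fin n)) : Prop :=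
  ∀ (i : Fin n) (h : (i : ℕ) + 1 < n),
    if Even (i : ℕ) then π ⟨(i : ℕ) + 1, h⟩ < π i else π i < π ⟨(i : ℕ) + 1, h⟩

/-- The Euler number `Eₙ`: the number of alternating permutations of `[n]`. -/
noncomputable def eulerNumber (n : ℕ) : ℕ :=
  Nat.card {π : Equiv.Perm (Fin n) // IsAlternating π}


namespace EulerAux
open Finset

/-- Prepend the value `j` to the permutation `σ`. -/
def consPerm {n : ℕ} (j : Fin (n + 1)) (σ : Equiv.Perm (Fin n)) : Equiv.Perm (Fin (n + 1)) :=
  (Fin.cycleRange j).symm * Equiv.Perm.decomposeFin.symm (0, σ)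

lemma consPerm_zero {n : ℕ} (j : Fin (n + 1)) (σ : Equiv.Perm (Fin n)) : consPerm j σ 0 = j := by
  simp [consPerm]

lemma consPerm_succ {n : ℕ} (j : Fin (n + 1)) (σ : Equiv.Perm (Fin n)) (i : Fin n) :
    consPerm j σ i.succ = j.succAbove (σ i) := by
  simp [consPerm]

lemma consPerm_inj {n : ℕ} {j j' : Fin (n + 1)} {σ σ' : Equiv.Perm (Fin n)}
    (h : consPerm j σ = consPerm j' σ') : j = j' ∧ σ = σ' := by
  have h0 : j = j' := by
    have := congrArg (fun f => f 0) h
    simpa [consPerm_zero] using this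
  subst h0
  refine ⟨rfl, Equiv.ext fun i => ?_⟩
  have := congrArg (fun f => f i.succ) h
  simpa [consPerm_succ] using this

lemma consPerm_surj {n : ℕ} (π : Equiv.Perm (Fin (n + 1))) : ∃ σ, consPerm (π 0) σ = π := by
  have hb : Function.Bijective
      (fun p : Fin (n + 1) × Equiv.Perm (Fin n) => consPerm p.1 p.2) := by
    rw [Fintype.bijective_iff_injective_and_card]
    refine ⟨fun p q h => Prod.ext (consPerm_inj h).1 (consPerm_inj h).2, ?_⟩
    simp [Fintype.card_perm, Nat.factorial_succ]
  obtain ⟨⟨j, σ⟩, h⟩ := hb.2 π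
  simp only at h
  refine ⟨σ, ?_⟩
  rw [← h, consPerm_zero]

lemma alt_cons {n : ℕ} (j : Fin (n + 2)) (σ : Equiv.Perm (Fin (n + 1))) :
    IsAlternating (consPerm j (Fin.revPerm * σ)) ↔ (IsAlternating σ ∧ n - (σ 0 : ℕ) < j) := by
  have key : ∀ a b : Fin (n + 1), j.succAbove (Fin.rev a) < j.succAbove (Fin.rev b) ↔ b < a := by
    intro a b
    rw [(Fin.strictMono_succAbove j).lt_iff_lt, Fin.rev_lt_rev]
  have e1 : ∀ (m : ℕ) (h : m + 1 < n + 2), consPerm j (Fin.revPerm * σ) ⟨m + 1, h⟩ =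
      j.succAbove (Fin.rev (σ ⟨m, by omega⟩)) := by
    intro m h
    have := consPerm_succ j (Fin.revPerm * σ) ⟨m, by omega⟩
    simpa using this
  have e0 : ∀ h : 0 < n + 2, consPerm j (Fin.revPerm * σ) ⟨0, h⟩ = j :=
    fun _ => consPerm_zero j _
  constructor
  · intro H
    constructor
    · intro i hi
      have := H ⟨i + 1, by omega⟩ (by simp; omega)
      simp only [e1, key, Nat.even_add_one] at this
      by_cases hE : Even (i : ℕ)
      · simpa [hE] using this
      · simpa [hE] using this
    · have := H ⟨0, by omega⟩ (by simp)
      simp only [e1, e0] at this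
      simp only [Even.zero, if_true] at this
      rw [Fin.succAbove_lt_iff_castSucc_lt, Fin.lt_def] at this
      simp [Fin.val_rev] at this
      have h0 : (⟨0, by omega⟩ : Fin (n + 1)) = 0 := rfl
      omega
  · rintro ⟨H, hj⟩ ⟨i, hi'⟩ hi
    rcases i with _ | i
    · simp only [e1, e0]
      simp only [Even.zero, if_true]
      rw [Fin.succAbove_lt_iff_castSucc_lt, Fin.lt_def]
      simp [Fin.val_rev]
      have h0 : (⟨0, by omega⟩ : Fin (n + 1)) = 0 := rfl
      omega
    · have := H ⟨i, by omega⟩ (by simp at hi ⊢; omega)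
      simp only [e1, key, Nat.even_add_one]
      by_cases hE : Even (i : ℕ)
      · simpa [hE] using this
      · simpa [hE] using this

open Classical in
/-- Alternating permutations of `Fin (n + 1)`, as a finset. -/
noncomputable def altSet (n : ℕ) : Finset (Equiv.Perm (Fin (n + 1))) :=
  univ.filter fun π => IsAlternating π

/-- Entringer counts: alternating permutations with first value `j`. -/
noncomputable def cnt (n j : ℕ) : ℕ := #{π ∈ altSet n | (π 0 : ℕ) = j}

lemma mem_altSet {n : ℕ} {π : Equiv.Perm (Fin (n + 1))} : π ∈ altSet n ↔ IsAlternating π := by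
  simp [altSet]

lemma euler_succ_card (n : ℕ) : eulerNumber (n + 1) = #(altSet n) := by
  classical
  rw [eulerNumber, Nat.card_eq_fintype_card, Fintype.card_subtype, altSet]

lemma card_filter_lt (n j : ℕ) (hj : j ≤ n + 1) :
    #{π ∈ altSet n | n - (π 0 : ℕ) < j} = ∑ i ∈ range j, cnt n (n - i) := by
  rw [card_eq_sum_card_fiberwise (f := fun π => n - (π 0 : ℕ)) (t := range j)]
  · refine sum_congr rfl fun i hi => ?_
    rw [cnt, filter_filter]
    congr 1
    refine filter_congr fun π _ => ?_
    have := (π 0).isLt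
    simp at hi
    omega
  · intro π hπ
    simp at hπ ⊢
    exact hπ.2

lemma cnt_succ (n j : ℕ) (hj : j ≤ n + 1) :
    cnt (n + 1) j = ∑ i ∈ range j, cnt n (n - i) := by
  rw [← card_filter_lt n j hj, cnt]
  symm
  refine card_bij (fun σ _ => consPerm ⟨j, by omega⟩ (Fin.revPerm * σ)) ?_ ?_ ?_
  · intro σ hσ
    simp only [mem_filter, mem_altSet] at hσ ⊢
    rw [alt_cons, consPerm_zero]
    exact ⟨hσ, rfl⟩
  · intro σ _ σ' _ h
    have := (consPerm_inj h).2
    exact mul_left_cancel this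
  · intro π hπ
    simp only [mem_filter, mem_altSet] at hπ
    obtain ⟨σ, hσ⟩ := consPerm_surj π
    have hj' : π 0 = ⟨j, by omega⟩ := Fin.ext hπ.2
    rw [hj'] at hσ
    have h2 : Fin.revPerm * (Fin.revPerm⁻¹ * σ) = σ := by simp
    refine ⟨Fin.revPerm⁻¹ * σ, ?_, ?_⟩
    · simp only [mem_filter, mem_altSet]
      have := (alt_cons ⟨j, by omega⟩ (Fin.revPerm⁻¹ * σ)).1 (by rw [h2, hσ]; exact hπ.1)
      exact this
    · rw [h2, hσ]

lemma cnt_zero_zero : cnt 0 0 = 1 := by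
  have : altSet 0 = univ := by
    ext π
    simp only [mem_altSet, mem_univ, iff_true]
    intro i h
    omega
  rw [cnt, this]
  simp

lemma euler_eq_cnt (n : ℕ) : eulerNumber n = cnt n n := by
  rcases n with _ | n
  · rw [cnt_zero_zero, eulerNumber, Nat.card_eq_one_iff_unique]
    refine ⟨⟨fun a b => Subtype.ext (Subsingleton.elim _ _)⟩, ⟨⟨1, fun i => i.elim0⟩⟩⟩
  · rw [cnt_succ _ _ le_rfl, ← card_filter_lt n _ le_rfl, euler_succ_card]
    congr 1
    rw [filter_true_of_mem]
    intro π _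
    omega

/-- `t p q` -/
noncomputable def tt (p q : ℕ) : ℕ := cnt (p + q) p

lemma tt_succ (p q : ℕ) : tt (p + 1) q = tt p (q + 1) + tt q p := by
  have h1 : tt (p + 1) q = cnt ((p + q) + 1) (p + 1) := by
    rw [tt]; congr 1; omega
  have h2 : tt p (q + 1) = cnt ((p + q) + 1) p := by
    rw [tt]; congr 1
  rw [h1, h2, cnt_succ _ _ (by omega), cnt_succ _ _ (by omega), sum_range_succ, tt]
  congr 2 <;> omega

lemma tt_zero_succ (q : ℕ) : tt 0 (q + 1) = 0 := by
  rw [tt, show 0 + (q + 1) = q + 1 by omega, cnt_succ _ _ (by omega)]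
  simp

lemma tt_zero_zero : tt 0 0 = 1 := cnt_zero_zero

lemma euler_eq_tt (n : ℕ) : eulerNumber n = tt n 0 := euler_eq_cnt n

lemma euler_le (n : ℕ) : eulerNumber n ≤ n.factorial := by
  rw [eulerNumber]
  calc _ ≤ Nat.card (Equiv.Perm (Fin n)) := Finite.card_subtype_le _
    _ = _ := by simp [Nat.card_eq_fintype_card, Fintype.card_perm]

/-- computable version -/
def zz : ℕ → ℕ → ℕ
  | 0, _ => 1
  | n + 1, j => ∑ i ∈ range j, zz n (n - i)

lemma cnt_eq_zz (n : ℕ) : ∀ j ≤ n, cnt n j = zz n j := by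
  induction n with
  | zero => intro j hj; obtain rfl : j = 0 := by omega
            rw [cnt_zero_zero, zz]
  | succ n ih =>
    intro j hj
    rw [cnt_succ _ _ hj, zz]
    exact sum_congr rfl fun i _ => ih _ (by omega)

lemma euler_eq_zz (n : ℕ) : eulerNumber n = zz n n := by
  rw [euler_eq_cnt, cnt_eq_zz n n le_rfl]

lemma euler_vals : eulerNumber 1 = 1 ∧ eulerNumber 2 = 1 ∧ eulerNumber 3 = 2 ∧ eulerNumber 4 = 5 ∧
    eulerNumber 5 = 16 ∧ eulerNumber 6 = 61 ∧ eulerNumber 7 = 272 ∧ eulerNumber 8 = 1385 := by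
  simp only [euler_eq_zz]
  simp [zz, sum_range_succ]

open Complex in
/-- Taylor coefficients of `sin`. -/
noncomputable def sc (n : ℕ) : ℂ := (I ^ n - (-I) ^ n) / (2 * I)

open Complex in
/-- Taylor coefficients of `cos`. -/
noncomputable def cc (n : ℕ) : ℂ := (I ^ n + (-I) ^ n) / 2

lemma sc_zero : sc 0 = 0 := by simp [sc]
lemma sc_one : sc 1 = 1 := by
  simp only [sc, pow_one]
  field_simp
  ring
lemma sc_add_two (n : ℕ) : sc (n + 2) = - sc n := by
  simp only [sc, pow_add, neg_sq, Complex.I_sq]; ring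
lemma cc_zero : cc 0 = 1 := by simp [cc]
lemma cc_one : cc 1 = 0 := by simp [cc]
lemma cc_add_two (n : ℕ) : cc (n + 2) = - cc n := by
  simp only [cc, pow_add, neg_sq, Complex.I_sq]; ring

/-- Binomial convolution. -/
noncomputable def VV (f g : ℕ → ℂ) (p q : ℕ) : ℂ :=
  ∑ x ∈ antidiagonal p, (p.choose x.1 : ℂ) * (f x.1 * g (x.2 + q))

lemma VV_zero (f g : ℕ → ℂ) (q : ℕ) : VV f g 0 q = f 0 * g q := by simp [VV]

lemma VV_succ (f g : ℕ → ℂ) (p q : ℕ) :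
    VV f g (p + 1) q = VV f g p (q + 1) + VV (fun n => f (n + 1)) g p q := by
  simp only [VV]
  rw [Finset.sum_antidiagonal_choose_succ_mul (fun i j => f i * g (j + q)) p]
  congr 1
  · refine sum_congr rfl fun x _ => ?_
    rw [show x.2 + 1 + q = x.2 + (q + 1) by omega]
  · refine sum_congr rfl fun x hx => ?_
    rw [HasAntidiagonal.mem_antidiagonal] at hx
    rw [show p.choose x.2 = p.choose x.1 from (Nat.choose_symm_of_eq_add (by omega)).symm]

lemma VV_neg (f g : ℕ → ℂ) (p q : ℕ) : VV (fun n => - f n) g p q = - VV f g p q := by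
  simp [VV, sum_neg_distrib]

lemma VV_add_two (f g : ℕ → ℂ) (hf : ∀ n, f (n + 2) = - f n) (p q : ℕ) :
    VV f g (p + 2) q = 2 * VV f g (p + 1) (q + 1) - VV f g p (q + 2) - VV f g p q := by
  have h1 := VV_succ f g (p + 1) q
  have h2 := VV_succ (fun n => f (n + 1)) g p q
  have h3 := VV_succ f g p (q + 1)
  have h4 : (fun n => f (n + 1 + 1)) = fun n => - f n := funext hf
  simp only [h4] at h2
  rw [VV_neg] at h2
  rw [h1, h2]
  linear_combination -h3

/-- Euler numbers as complex numbers. -/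
noncomputable def EE (n : ℕ) : ℂ := (eulerNumber n : ℂ)

lemma tt_add_two (p q : ℕ) :
    (tt (p + 2) q : ℂ) = 2 * tt (p + 1) (q + 1) - tt p (q + 2) - tt p q := by
  have h1 := tt_succ (p + 1) q
  have h2 := tt_succ p (q + 1)
  have h3 := tt_succ q p
  have e1 : (tt (p + 2) q : ℂ) = tt (p + 1) (q + 1) + tt q (p + 1) := by exact_mod_cast h1
  have e2 : (tt (p + 1) (q + 1) : ℂ) = tt p (q + 2) + tt (q + 1) p := by exact_mod_cast h2
  have e3 : (tt (q + 1) p : ℂ) = tt q (p + 1) + tt p q := by exact_mod_cast h3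
  linear_combination e1 - e2 - e3

lemma tt_formula (p : ℕ) : ∀ q, (tt p q : ℂ) =
    VV cc (fun n => if n = 0 then 1 else 0) p q + VV sc EE p q := by
  induction p using Nat.strong_induction_on with
  | _ p ih =>
    intro q
    match p, ih with
    | 0, _ =>
      rw [VV_zero, VV_zero, sc_zero, cc_zero]
      rcases q with _ | q
      · simp [tt_zero_zero]
      · simp [tt_zero_succ]
    | 1, _ =>
      rw [VV_succ, VV_succ, VV_zero, VV_zero, VV_zero, VV_zero, sc_zero, cc_zero, tt_succ,
        tt_zero_succ]
      simp [cc_one, sc_one, EE, euler_eq_tt]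
    | p + 2, ih =>
      rw [VV_add_two _ _ cc_add_two, VV_add_two _ _ sc_add_two, tt_add_two,
        ih (p + 1) (by omega), ih p (by omega), ih p (by omega)]
      ring

lemma EE_formula (n : ℕ) : EE n = cc n + ∑ x ∈ antidiagonal n,
    (n.choose x.1 : ℂ) * (sc x.1 * EE x.2) := by
  have h := tt_formula n 0
  have h1 : VV cc (fun n => if n = 0 then 1 else 0) n 0 = cc n := by
    rw [VV, sum_eq_single (n, 0)]
    · simp
    · rintro ⟨a, b⟩ hab hne
      have : b ≠ 0 := by
        rintro rfl
        simp at hab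
        exact hne (by rw [hab])
      simp [this]
    · intro h; simp at h
  rw [h1] at h
  rw [EE, euler_eq_tt, h]
  rfl

lemma EE_formula' (n : ℕ) (z : ℂ) : EE n * z ^ n / n.factorial = cc n * z ^ n / n.factorial +
    ∑ x ∈ antidiagonal n, (sc x.1 * z ^ x.1 / x.1.factorial) * (EE x.2 * z ^ x.2 / x.2.factorial)
    := by
  conv_lhs => rw [EE_formula n]
  rw [add_mul, add_div]
  congr 1
  rw [sum_mul, sum_div]
  refine sum_congr rfl fun x hx => ?_
  rw [HasAntidiagonal.mem_antidiagonal] at hx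
  subst hx
  rw [Nat.cast_add_choose]
  have h1 : ((x.1 + x.2).factorial : ℂ) ≠ 0 := by exact_mod_cast Nat.factorial_ne_zero _
  have h2 : (x.1.factorial : ℂ) ≠ 0 := by exact_mod_cast Nat.factorial_ne_zero _
  have h3 : (x.2.factorial : ℂ) ≠ 0 := by exact_mod_cast Nat.factorial_ne_zero _
  field_simp
  ring

open Complex in
lemma hasSum_exp' (z : ℂ) : HasSum (fun n : ℕ => z ^ n / n.factorial) (exp z) := by
  rw [Complex.exp_eq_exp_ℂ]
  exact NormedSpace.expSeries_div_hasSum_exp z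

open Complex in
lemma hasSum_sc (z : ℂ) : HasSum (fun n : ℕ => sc n * z ^ n / n.factorial) (sin z) := by
  have h := ((hasSum_exp' (I * z)).sub (hasSum_exp' (-I * z))).div_const (2 * I)
  have e1 : (fun n : ℕ => sc n * z ^ n / n.factorial) = fun n : ℕ =>
      ((I * z) ^ n / n.factorial - (-I * z) ^ n / n.factorial) / (2 * I) := by
    funext n
    rw [sc, mul_pow, mul_pow]
    ring
  have e2 : Complex.sin z = (cexp (I * z) - cexp (-I * z)) / (2 * I) := by
    have h2 := Complex.two_sin z
    have : I ≠ 0 := I_ne_zero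
    rw [mul_comm I z, show -I * z = -z * I by ring, eq_div_iff (by simp)]
    linear_combination I * h2 + (cexp (-z * I) - cexp (z * I)) * I_sq
  rw [e1, e2]
  exact h

open Complex in
lemma hasSum_cc (z : ℂ) : HasSum (fun n : ℕ => cc n * z ^ n / n.factorial) (cos z) := by
  have h := ((hasSum_exp' (I * z)).add (hasSum_exp' (-I * z))).div_const 2
  have e1 : (fun n : ℕ => cc n * z ^ n / n.factorial) = fun n : ℕ =>
      ((I * z) ^ n / n.factorial + (-I * z) ^ n / n.factorial) / 2 := by
    funext n
    rw [cc, mul_pow, mul_pow]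
    ring
  have e2 : Complex.cos z = (cexp (I * z) + cexp (-I * z)) / 2 := by
    have h2 := Complex.two_cos z
    rw [mul_comm I z, show -I * z = -z * I by ring, eq_div_iff (by simp)]
    linear_combination h2
  rw [e1, e2]
  exact h

lemma summable_EE {z : ℂ} (hz : ‖z‖ < 1) :
    Summable (fun n : ℕ => ‖EE n * z ^ n / n.factorial‖) := by
  refine Summable.of_nonneg_of_le (fun _ => norm_nonneg _) (fun n => ?_)
    (summable_geometric_of_lt_one (norm_nonneg z) hz)
  have h1 : (0 : ℝ) < n.factorial := by exact_mod_cast Nat.factorial_pos n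
  have h2 : (eulerNumber n : ℝ) ≤ n.factorial := by exact_mod_cast euler_le n
  rw [norm_div, norm_mul, norm_pow, EE, Complex.norm_natCast, Complex.norm_natCast, div_le_iff₀ h1,
    mul_comm]
  gcongr

/-- The exponential generating function. -/
noncomputable def GG (z : ℂ) : ℂ := ∑' n : ℕ, EE n * z ^ n / n.factorial

open Complex in
lemma GG_eq {z : ℂ} (hz : ‖z‖ < 1) : GG z = cos z + sin z * GG z := by
  have hs := hasSum_sc z
  have hS : Summable (fun n : ℕ => ‖sc n * z ^ n / n.factorial‖) := hs.summable.norm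
  have hE := summable_EE hz
  have h := tsum_mul_tsum_eq_tsum_sum_antidiagonal_of_summable_norm hS hE
  have h' := summable_norm_sum_mul_antidiagonal_of_summable_norm hS hE
  rw [hs.tsum_eq] at h
  conv_rhs => rw [GG, h, ← (hasSum_cc z).tsum_eq]
  rw [← (hasSum_cc z).summable.tsum_add h'.of_norm, GG]
  exact tsum_congr fun n => EE_formula' n z

/-- reciprocals of the poles, positive side -/
noncomputable def uu (n : ℕ) : ℝ := 1 / (n + 1 + 1 / 4)
/-- reciprocals of the poles, negative side -/
noncomputable def vv (n : ℕ) : ℝ := 1 / (1 / 4 - (n + 1))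

lemma uu_pos (n : ℕ) : 0 < uu n := by unfold uu; positivity
lemma vv_neg (n : ℕ) : vv n < 0 := by
  unfold vv
  rw [one_div, inv_lt_zero]
  have : (0 : ℝ) ≤ n := Nat.cast_nonneg n
  linarith

lemma abs_uu_le (n : ℕ) : |uu n| ≤ (4 / 3) / (n + 1) := by
  rw [abs_of_pos (uu_pos n), uu]
  have : (0 : ℝ) ≤ n := Nat.cast_nonneg n
  rw [div_le_div_iff₀ (by positivity) (by positivity)]
  linarith

lemma abs_vv_le (n : ℕ) : |vv n| ≤ (4 / 3) / (n + 1) := by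
  have : (0 : ℝ) ≤ n := Nat.cast_nonneg n
  have h : -vv n = 1 / (n + 1 - 1 / 4) := by
    rw [vv, ← div_neg]; congr 1; ring
  rw [abs_of_neg (vv_neg n), h]
  rw [div_le_div_iff₀ (by linarith) (by positivity)]
  linarith

lemma pair_bound (n m : ℕ) :
    |uu n ^ (m + 1) + vv n ^ (m + 1)| * (1 / 6) ^ m ≤ 3 * (1 / ((n : ℝ) + 1) ^ 2) * (1 / 2) ^ m := by
  have hn : (0 : ℝ) ≤ n := Nat.cast_nonneg n
  rcases m with _ | m
  · have h : uu n + vv n = - (1 / 2 / ((n + 1 + 1 / 4) * (n + 1 - 1 / 4))) := by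
      rw [uu, vv]
      have h1 : (n : ℝ) + 1 + 1 / 4 ≠ 0 := by positivity
      have h2 : (n : ℝ) + 1 - 1 / 4 ≠ 0 := by linarith
      have h3 : 1 / 4 - ((n : ℝ) + 1) ≠ 0 := by linarith
      rw [div_add_div _ _ h1 h3, ← neg_div, div_eq_div_iff (mul_ne_zero h1 h3) (mul_ne_zero h1 h2)]
      ring
    have h2 : (0 : ℝ) < (n + 1 + 1 / 4) * (n + 1 - 1 / 4) := by
      apply mul_pos <;> linarith
    simp only [zero_add, pow_one, pow_zero, mul_one]
    rw [h, abs_neg, abs_of_pos (by positivity), ← mul_div_assoc, div_le_div_iff₀ h2 (by positivity)]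
    nlinarith
  · have hle : (4 / 3) / ((n : ℝ) + 1) ≤ 4 / 3 := by
      apply div_le_self <;> linarith
    have hb : ∀ x : ℝ, |x| ≤ (4 / 3) / (n + 1) →
        |x ^ (m + 2)| ≤ (4 / 3) ^ m * ((4 / 3) / (n + 1)) ^ 2 := by
      intro x hx
      rw [abs_pow, pow_add]
      have := hx.trans hle
      gcongr
    calc |uu n ^ (m + 2) + vv n ^ (m + 2)| * (1 / 6) ^ (m + 1)
        ≤ ((4 / 3) ^ m * ((4 / 3) / (n + 1)) ^ 2 + (4 / 3) ^ m * ((4 / 3) / (n + 1)) ^ 2)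
          * (1 / 6) ^ (m + 1) := by
          gcongr
          exact (abs_add_le _ _).trans (add_le_add (hb _ (abs_uu_le n)) (hb _ (abs_vv_le n)))
      _ = (16 / 27) * (1 / ((n : ℝ) + 1) ^ 2) * (2 / 9) ^ m := by
          rw [show (2 / 9 : ℝ) = 4 / 3 * (1 / 6) by norm_num, mul_pow]
          field_simp
          ring
      _ ≤ (3 / 2) * (1 / ((n : ℝ) + 1) ^ 2) * (1 / 2) ^ m := by
          gcongr ?_ * _ * ?_ ^ m <;> norm_num
      _ = _ := by rw [pow_succ]; ring

/-- double series terms -/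
noncomputable def FF (y : ℂ) (x : ℕ × ℕ) : ℂ :=
  ((uu x.1 : ℂ) ^ (x.2 + 1) + (vv x.1 : ℂ) ^ (x.2 + 1)) * y ^ x.2

lemma FF_summable {y : ℂ} (hy : ‖y‖ < 1 / 6) : Summable (FF y) := by
  have h1 : Summable (fun n : ℕ => 3 * (1 / ((n : ℝ) + 1) ^ 2)) := by
    apply Summable.mul_left
    have := (summable_nat_add_iff 1).2 (Real.summable_one_div_nat_pow.2 (one_lt_two))
    simpa using this
  have h2 : Summable (fun m : ℕ => (1 / 2 : ℝ) ^ m) := summable_geometric_two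
  have h3 := h1.mul_of_nonneg h2 (fun n => by positivity) (fun n => by positivity)
  refine Summable.of_norm_bounded h3 ?_
  rintro ⟨n, m⟩
  refine le_trans ?_ (pair_bound n m)
  rw [FF, norm_mul, norm_pow]
  have : ((uu n : ℂ) ^ (m + 1) + (vv n : ℂ) ^ (m + 1)) =
    ((uu n ^ (m + 1) + vv n ^ (m + 1) : ℝ) : ℂ) := by push_cast; rfl
  simp only
  rw [this, Complex.norm_real, Real.norm_eq_abs]
  gcongr

lemma geom_aux {a y : ℂ} (ha : a ≠ 0) (h : ‖a * y‖ < 1) :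
    HasSum (fun m : ℕ => a ^ (m + 1) * y ^ m) (1 / (1 / a - y)) := by
  have := (hasSum_geometric_of_norm_lt_one h).mul_left a
  have e1 : (fun m : ℕ => a ^ (m + 1) * y ^ m) = fun m : ℕ => a * (a * y) ^ m := by
    funext m; rw [mul_pow, pow_succ]; ring
  have e2 : 1 / (1 / a - y) = a * (1 - a * y)⁻¹ := by
    rw [← div_eq_mul_inv]
    have h2 : 1 - a * y ≠ 0 := by
      intro h0
      have : a * y = 1 := by linear_combination -h0
      rw [this] at h; simp at h
    have : 1 / a - y = (1 - a * y) / a := by field_simp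
    rw [this, one_div_div]
  rw [e1, e2]
  exact this

lemma uu_y {y : ℂ} (hy : ‖y‖ < 1 / 6) (x : ℝ) (n : ℕ) (hx : |x| ≤ (4 / 3) / (n + 1)) :
    ‖(x : ℂ) * y‖ < 1 := by
  rw [norm_mul, Complex.norm_real, Real.norm_eq_abs]
  have : (4 / 3) / ((n : ℝ) + 1) ≤ 4 / 3 := by
    have hn : (0 : ℝ) ≤ n := Nat.cast_nonneg n
    apply div_le_self <;> linarith
  have h0 := norm_nonneg y
  nlinarith [abs_nonneg x]

lemma FF_row {y : ℂ} (hy : ‖y‖ < 1 / 6) (n : ℕ) : HasSum (fun m => FF y (n, m))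
    (1 / ((1 / 4 - y) - (n + 1)) + 1 / ((1 / 4 - y) + (n + 1))) := by
  have h1 := geom_aux (a := (uu n : ℂ)) (by exact_mod_cast (uu_pos n).ne') (uu_y hy _ n (abs_uu_le n))
  have h2 := geom_aux (a := (vv n : ℂ)) (by exact_mod_cast (vv_neg n).ne) (uu_y hy _ n (abs_vv_le n))
  have h := h2.add h1
  have e1 : 1 / (uu n : ℂ) - y = (1 / 4 - y) + (n + 1) := by
    rw [uu]; push_cast; rw [one_div_one_div]; ring
  have e2 : 1 / (vv n : ℂ) - y = (1 / 4 - y) - (n + 1) := by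
    rw [vv]; push_cast; rw [one_div_one_div]; ring
  rw [e1, e2] at h
  have e3 : (fun m => FF y (n, m)) = fun m : ℕ =>
      (vv n : ℂ) ^ (m + 1) * y ^ m + (uu n : ℂ) ^ (m + 1) * y ^ m := by
    funext m; rw [FF]; ring
  rw [e3]
  exact h

/-- coefficients -/
noncomputable def RR (m : ℕ) : ℝ := ∑' n : ℕ, (uu n ^ (m + 1) + vv n ^ (m + 1))

lemma mem_compl {y : ℂ} (hy : ‖y‖ < 1 / 6) : (1 / 4 - y) ∈ Complex.integerComplement := by
  rintro ⟨k, hk⟩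
  have h : y = ((1 / 4 - k : ℝ) : ℂ) := by push_cast; linear_combination hk
  rw [h, Complex.norm_real, Real.norm_eq_abs, abs_lt] at hy
  have h1 : (k : ℝ) < 1 := by linarith [hy.1]
  have h2 : (0 : ℝ) < k := by linarith [hy.2]
  have h1' : k < 1 := by exact_mod_cast h1
  have h2' : 0 < k := by exact_mod_cast h2
  omega

lemma summable_pair (m : ℕ) : Summable (fun n : ℕ => uu n ^ (m + 1) + vv n ^ (m + 1)) := by
  have h1 : Summable (fun n : ℕ => 3 * (1 / ((n : ℝ) + 1) ^ 2)) := by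
    apply Summable.mul_left
    have := (summable_nat_add_iff 1).2 (Real.summable_one_div_nat_pow.2 (one_lt_two))
    simpa using this
  refine Summable.of_norm_bounded ((h1.mul_right ((1 / 2) ^ m)).mul_right (6 ^ m)) fun n => ?_
  have h := mul_le_mul_of_nonneg_right (pair_bound n m) (show (0 : ℝ) ≤ 6 ^ m by positivity)
  rw [mul_assoc, ← mul_pow] at h
  norm_num at h ⊢
  exact h

lemma cot_hasSum {y : ℂ} (hy : ‖y‖ < 1 / 6) :
    HasSum (fun m : ℕ => ((4 ^ (m + 1) + RR m : ℝ) : ℂ) * y ^ m)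
      (Real.pi * Complex.cot (Real.pi * (1 / 4 - y))) := by
  have h0 := geom_aux (a := (4 : ℂ)) (y := y) (by norm_num) (by
    rw [norm_mul]; simp; linarith)
  have hS := FF_summable hy
  have h1 := hS.hasSum.prod_fiberwise (FF_row hy)
  have h2 := (Equiv.prodComm ℕ ℕ).hasSum_iff.2 hS.hasSum
  have h3 : ∀ m : ℕ, HasSum (fun n => FF y (n, m)) ((RR m : ℂ) * y ^ m) := by
    intro m
    have h := (Complex.hasSum_ofReal.2 (summable_pair m).hasSum).mul_right (y ^ m)
    have e : (fun n => FF y (n, m)) = fun n : ℕ =>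
        ((uu n ^ (m + 1) + vv n ^ (m + 1) : ℝ) : ℂ) * y ^ m := by
      funext n; rw [FF]; push_cast; rfl
    rw [e]
    exact h
  have h4 := h2.prod_fiberwise h3
  have hc := cot_series_rep' (mem_compl hy)
  rw [h1.tsum_eq, sub_eq_iff_eq_add'] at hc
  rw [hc]
  have h5 := h0.add h4
  have e : (fun m : ℕ => ((4 ^ (m + 1) + RR m : ℝ) : ℂ) * y ^ m) = fun m : ℕ =>
      4 ^ (m + 1) * y ^ m + (RR m : ℂ) * y ^ m := by
    funext m; push_cast; ring
  rw [e]
  exact h5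

lemma GG_cot {z : ℂ} (hz : ‖z‖ < 1) :
    GG z = Complex.cot (Real.pi * (1 / 4 - z / (2 * Real.pi))) := by
  have hpi : (Real.pi : ℂ) ≠ 0 := by exact_mod_cast Real.pi_ne_zero
  have hy : ‖z / (2 * Real.pi)‖ < 1 / 6 := by
    have := Real.pi_gt_three
    rw [norm_div, norm_mul, Complex.norm_real, Real.norm_of_nonneg Real.pi_pos.le,
      div_lt_div_iff₀ (by simp [Real.pi_pos]) (by norm_num)]
    simp
    linarith
  have hs := sin_pi_mul_ne_zero (mem_compl hy)
  set w : ℂ := Real.pi * (1 / 4 - z / (2 * Real.pi)) with hw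
  have hzw : z = Real.pi / 2 - 2 * w := by rw [hw]; field_simp; ring
  have h := GG_eq hz
  have e1 : Complex.sin z = 1 - 2 * Complex.sin w ^ 2 := by
    rw [hzw, Complex.sin_pi_div_two_sub, Complex.cos_two_mul, Complex.cos_sq']; ring
  have e2 : Complex.cos z = 2 * Complex.sin w * Complex.cos w := by
    rw [hzw, Complex.cos_pi_div_two_sub, Complex.sin_two_mul]
  rw [Complex.cot, eq_div_iff hs]
  rw [e1, e2] at h
  have h2 : 2 * Complex.sin w * (GG z * Complex.sin w - Complex.cos w) = 0 := by
    linear_combination h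
  rcases mul_eq_zero.1 h2 with h3 | h3
  · exact absurd h3 (mul_ne_zero two_ne_zero hs)
  · linear_combination h3

open Topology Filter in
lemma coeff_unique (a b : ℕ → ℂ) (f : ℂ → ℂ)
    (ha : ∀ z : ℂ, ‖z‖ < 1 → HasSum (fun n => a n * z ^ n) (f z))
    (hb : ∀ z : ℂ, ‖z‖ < 1 → HasSum (fun n => b n * z ^ n) (f z)) (n : ℕ) : a n = b n := by
  have key : ∀ c : ℕ → ℂ, (∀ z : ℂ, ‖z‖ < 1 → HasSum (fun n => c n * z ^ n) (f z)) →
      HasFPowerSeriesAt f (FormalMultilinearSeries.ofScalars ℂ c) 0 := by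
    intro c hc
    rw [hasFPowerSeriesAt_iff]
    filter_upwards [Metric.ball_mem_nhds (0 : ℂ) one_pos] with z hz
    have := hc z (by simpa using hz)
    simpa [FormalMultilinearSeries.coeff_ofScalars, mul_comm] using this
  have h := (key a ha).eq_formalMultilinearSeries (key b hb)
  have h2 := congrArg (fun p => FormalMultilinearSeries.coeff p n) h
  simpa [FormalMultilinearSeries.coeff_ofScalars] using h2

lemma euler_formula (n : ℕ) : (eulerNumber n : ℝ) / n.factorial =
    (4 ^ (n + 1) + RR n) / (Real.pi * (2 * Real.pi) ^ n) := by
  have hpi : (Real.pi : ℂ) ≠ 0 := by exact_mod_cast Real.pi_ne_zero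
  have h := coeff_unique (fun n => ((eulerNumber n : ℝ) / n.factorial : ℝ))
    (fun n => ((4 ^ (n + 1) + RR n) / (Real.pi * (2 * Real.pi) ^ n) : ℝ)) GG ?_ ?_ n
  · exact_mod_cast h
  · intro z hz
    have := (summable_EE hz).of_norm.hasSum
    have e : (fun n : ℕ => (((eulerNumber n : ℝ) / n.factorial : ℝ) : ℂ) * z ^ n) =
        fun n : ℕ => EE n * z ^ n / n.factorial := by
      funext n; rw [EE]; push_cast; ring
    rw [e]
    exact this
  · intro z hz
    have hy : ‖z / (2 * Real.pi)‖ < 1 / 6 := by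
      have := Real.pi_gt_three
      rw [norm_div, norm_mul, Complex.norm_real, Real.norm_of_nonneg Real.pi_pos.le,
        div_lt_div_iff₀ (by simp [Real.pi_pos]) (by norm_num)]
      simp
      linarith
    have h1 := (cot_hasSum hy).mul_left (1 / (Real.pi : ℂ))
    rw [← mul_assoc, one_div_mul_cancel hpi, one_mul, ← GG_cot hz] at h1
    have e : (fun n : ℕ => (((4 ^ (n + 1) + RR n) / (Real.pi * (2 * Real.pi) ^ n) : ℝ) : ℂ) * z ^ n)
        = fun n : ℕ => 1 / (Real.pi : ℂ) *
          (((4 ^ (n + 1) + RR n : ℝ) : ℂ) * (z / (2 * Real.pi)) ^ n) := by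
      funext n; push_cast; rw [div_pow]; field_simp
    rw [e]
    exact h1

lemma bb_hasSum : HasSum (fun n : ℕ => (1 / 2 : ℝ) * (1 / (4 * n + 2) - 1 / (4 * n + 6))) (1 / 4) := by
  rw [hasSum_iff_tendsto_nat_of_nonneg]
  · have h : ∀ N : ℕ, ∑ n ∈ range N, (1 / 2 : ℝ) * (1 / (4 * n + 2) - 1 / (4 * n + 6)) =
        1 / 4 - (1 / 2) * (1 / (4 * N + 2)) := by
      intro N
      induction N with
      | zero => norm_num
      | succ N ih => rw [sum_range_succ, ih]; push_cast; rw [show (4 * ((N : ℝ) + 1) + 2) = 4 * N + 6 by ring]; ring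
    simp only [h]
    have h2 : Filter.Tendsto (fun N : ℕ => (4 * (N : ℝ) + 2)) Filter.atTop Filter.atTop :=
      Filter.tendsto_atTop_add_const_right _ _
        (tendsto_natCast_atTop_atTop.const_mul_atTop (by norm_num))
    have h3 := h2.inv_tendsto_atTop
    have h4 := (h3.const_mul (1 / 2 : ℝ)).const_sub (1 / 4)
    simpa [one_div] using h4
  · intro n
    have : (1 : ℝ) / (4 * n + 6) ≤ 1 / (4 * n + 2) := by
      apply one_div_le_one_div_of_le <;> [positivity; linarith]
    linarith

/-- normalised Euler numbers -/
noncomputable def SS (n : ℕ) : ℝ := 1 + RR n / 4 ^ (n + 1)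

lemma SS_bound (m : ℕ) : |SS (m + 1) - 1| ≤ (1 / 4) * (1 / 3) ^ m := by
  have e : SS (m + 1) - 1 = ∑' n : ℕ, ((uu n / 4) ^ (m + 2) + (vv n / 4) ^ (m + 2)) := by
    rw [SS, RR, add_sub_cancel_left, ← tsum_div_const]
    refine tsum_congr fun n => ?_
    rw [div_pow, div_pow]; ring
  rw [e, ← Real.norm_eq_abs]
  refine tsum_of_norm_bounded (bb_hasSum.mul_right ((1 / 3) ^ m)) fun n => ?_
  have hn : (0 : ℝ) ≤ n := Nat.cast_nonneg n
  have hu : |uu n / 4| = 1 / (4 * n + 5) := by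
    rw [abs_of_pos (by have := uu_pos n; positivity), uu, div_div]; congr 1; ring
  have hv : |vv n / 4| = 1 / (4 * n + 3) := by
    rw [abs_of_neg (by have := vv_neg n; linarith), vv, div_div, ← div_neg]; congr 1; ring
  have hu3 : |uu n / 4| ≤ 1 / 3 := by
    rw [hu]; apply one_div_le_one_div_of_le <;> linarith
  have hv3 : |vv n / 4| ≤ 1 / 3 := by
    rw [hv]; apply one_div_le_one_div_of_le <;> linarith
  calc ‖(uu n / 4) ^ (m + 2) + (vv n / 4) ^ (m + 2)‖
      ≤ |uu n / 4| ^ (m + 2) + |vv n / 4| ^ (m + 2) := by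
        rw [Real.norm_eq_abs, ← abs_pow, ← abs_pow]; exact abs_add_le _ _
    _ ≤ (1 / 3) ^ m * |uu n / 4| ^ 2 + (1 / 3) ^ m * |vv n / 4| ^ 2 := by
        rw [pow_add, pow_add]; gcongr
    _ = ((1 / (4 * n + 5)) ^ 2 + (1 / (4 * n + 3)) ^ 2) * (1 / 3) ^ m := by rw [hu, hv]; ring
    _ ≤ _ := by
        gcongr
        have h1 : (1 / (4 * (n : ℝ) + 5)) ^ 2 ≤ 1 / ((4 * n + 4) * (4 * n + 6)) := by
          rw [one_div_pow]; apply one_div_le_one_div_of_le <;> [positivity; nlinarith]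
        have h2 : (1 / (4 * (n : ℝ) + 3)) ^ 2 ≤ 1 / ((4 * n + 2) * (4 * n + 4)) := by
          rw [one_div_pow]; apply one_div_le_one_div_of_le <;> [positivity; nlinarith]
        have h3 : 1 / ((4 * (n : ℝ) + 4) * (4 * n + 6)) + 1 / ((4 * n + 2) * (4 * n + 4)) =
            1 / 2 * (1 / (4 * n + 2) - 1 / (4 * n + 6)) := by
          field_simp; ring
        linarith

lemma euler_SS (n : ℕ) : (eulerNumber n : ℝ) =
    n.factorial * (4 / Real.pi) * (2 / Real.pi) ^ n * SS n := by
  have h := euler_formula n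
  have hf : (n.factorial : ℝ) ≠ 0 := by exact_mod_cast n.factorial_ne_zero
  rw [div_eq_iff hf] at h
  rw [h, SS, div_pow, mul_pow, show (4 : ℝ) ^ (n + 1) = 4 * (2 ^ n * 2 ^ n) by
    rw [← mul_pow]; norm_num [pow_succ]; ring]
  have := Real.pi_ne_zero
  field_simp

lemma prod_close {x y a b : ℝ} (hx : |x - 1| ≤ a) (hy : |y - 1| ≤ b) :
    |x * y - 1| ≤ a + b + a * b := by
  have h : x * y - 1 = (x - 1) + (y - 1) + (x - 1) * (y - 1) := by ring
  have ha : 0 ≤ a := (abs_nonneg _).trans hx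
  rw [h]
  refine (abs_add_le _ _).trans (add_le_add ((abs_add_le _ _).trans (add_le_add hx hy)) ?_)
  rw [abs_mul]
  exact mul_le_mul hx hy (abs_nonneg _) ha

/-- The second difference expression is close to `1`. -/
lemma DD_close {N d a b c : ℝ} (hN : 0 ≤ N) (hd0 : 0 ≤ d) (hd : d ≤ 1 / 20)
    (ha : |a - 1| ≤ d) (hb : |b - 1| ≤ d / 3) (hc : |c - 1| ≤ d / 9) :
    |((N + 2) * (a * c) - (N + 1) * b ^ 2) - 1| ≤ 2 * (N + 2) * d := by
  have h1 := abs_le.1 (prod_close ha hc)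
  have h2 := abs_le.1 (prod_close hb hb)
  have hdd : d * d ≤ d * (1 / 20) := mul_le_mul_of_nonneg_left hd hd0
  have h3 : |a * c - 1| ≤ 6 / 5 * d := abs_le.2 ⟨by linarith [h1.1], by linarith [h1.2]⟩
  have h4 : |b ^ 2 - 1| ≤ 7 / 10 * d := by
    rw [pow_two]; exact abs_le.2 ⟨by linarith [h2.1], by linarith [h2.2]⟩
  have h : ((N + 2) * (a * c) - (N + 1) * b ^ 2) - 1 =
    (N + 2) * (a * c - 1) - (N + 1) * (b ^ 2 - 1) := by ring
  have h5 := mul_le_mul_of_nonneg_left h3 (show 0 ≤ N + 2 by linarith)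
  have h6 := mul_le_mul_of_nonneg_left h4 (show 0 ≤ N + 1 by linarith)
  rw [h]
  refine (abs_sub _ _).trans ?_
  rw [abs_mul, abs_mul, abs_of_nonneg (show 0 ≤ N + 2 by linarith),
    abs_of_nonneg (show 0 ≤ N + 1 by linarith)]
  nlinarith [mul_nonneg hN hd0]

lemma real_core {N d s0 s1 s2 s3 s4 : ℝ} (hN : 5 ≤ N) (hd0 : 0 ≤ d)
    (hK : (N + 3) * (N + 2) * d ≤ 56 / 324)
    (h0 : |s0 - 1| ≤ d) (h1 : |s1 - 1| ≤ d / 3) (h2 : |s2 - 1| ≤ d / 9)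
    (h3 : |s3 - 1| ≤ d / 27) (h4 : |s4 - 1| ≤ d / 81) :
    0 ≤ (N + 2) * (s0 * s2) - (N + 1) * s1 ^ 2 ∧
    (N + 1) * ((N + 3) * (s1 * s3) - (N + 2) * s2 ^ 2) ^ 2 ≤
      (N + 3) * (((N + 2) * (s0 * s2) - (N + 1) * s1 ^ 2) *
        ((N + 4) * (s2 * s4) - (N + 3) * s3 ^ 2)) := by
  have hd : d ≤ 1 / 20 := by
    have : 56 * d ≤ (N + 3) * (N + 2) * d := by
      apply mul_le_mul_of_nonneg_right _ hd0; nlinarith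
    linarith
  have D0 := abs_le.1 (DD_close (N := N) (by linarith) hd0 hd h0 h1 h2)
  have D1 := abs_le.1 (DD_close (N := N + 1) (d := d / 3) (b := s2) (c := s3) (by linarith) (by linarith) (by linarith)
    h1 (by linarith) (by linarith))
  have D2 := abs_le.1 (DD_close (N := N + 2) (d := d / 9) (b := s3) (c := s4) (by linarith) (by linarith) (by linarith)
    h2 (by linarith) (by linarith))
  rw [show N + 1 + 2 = N + 3 by ring, show N + 1 + 1 = N + 2 by ring] at D1
  rw [show N + 2 + 2 = N + 4 by ring, show N + 2 + 1 = N + 3 by ring] at D2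
  set A := (N + 2) * (s0 * s2) - (N + 1) * s1 ^ 2
  set B := (N + 3) * (s1 * s3) - (N + 2) * s2 ^ 2
  set C := (N + 4) * (s2 * s4) - (N + 3) * s3 ^ 2
  -- e := 2 (N+2) d
  have hNd : 5 * d ≤ N * d := mul_le_mul_of_nonneg_right hN hd0
  obtain ⟨e, he⟩ : ∃ e, e = 2 * (N + 2) * d := ⟨_, rfl⟩
  have he0 : 0 ≤ e := by rw [he]; nlinarith
  have hNe : (N + 3) * e ≤ 112 / 324 := by rw [he]; nlinarith
  have he1 : e ≤ 1 / 20 := by nlinarith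
  have hA : 1 - e ≤ A := by linarith [D0.1]
  have hC : 1 - e ≤ C := by nlinarith [D2.1]
  have hB1 : B ≤ 1 + e := by nlinarith [D1.2]
  have hB0 : 0 ≤ B := by nlinarith [D1.1]
  refine ⟨by linarith, ?_⟩
  have hAC : (1 - e) * (1 - e) ≤ A * C := mul_le_mul hA hC (by linarith) (by linarith)
  have hBB : B ^ 2 ≤ (1 + e) ^ 2 := by gcongr
  have e1 : (N + 1) * B ^ 2 ≤ (N + 1) * (1 + e) ^ 2 :=
    mul_le_mul_of_nonneg_left hBB (by linarith)
  have e2 : (N + 3) * ((1 - e) * (1 - e)) ≤ (N + 3) * (A * C) :=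
    mul_le_mul_of_nonneg_left hAC (by linarith)
  have e3 : (N + 1) * (1 + e) ^ 2 ≤ (N + 3) * ((1 - e) * (1 - e)) := by
    nlinarith
  linarith

lemma K_bound (k : ℕ) : (((k + 5 : ℕ) : ℝ) + 3) * (((k + 5 : ℕ) : ℝ) + 2) *
    ((1 / 4) * (1 / 3) ^ (k + 4)) ≤ 56 / 324 := by
  induction k with
  | zero => norm_num
  | succ k ih =>
    refine le_trans ?_ ih
    rw [show k + 1 + 4 = (k + 4) + 1 by ring, pow_succ]
    have hp : (0 : ℝ) < (1 / 3) ^ (k + 4) := by positivity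
    have hk : (0 : ℝ) ≤ k := Nat.cast_nonneg k
    push_cast
    have : ((k : ℝ) + 1 + 5 + 3) * (k + 1 + 5 + 2) ≤ 3 * ((k + 5 + 3) * (k + 5 + 2)) := by nlinarith
    nlinarith [mul_le_mul_of_nonneg_right this hp.le]

lemma big_case (k : ℕ) :
    0 ≤ (eulerNumber (k + 5) : ℝ) * eulerNumber (k + 5 + 2) - (eulerNumber (k + 5 + 1) : ℝ) ^ 2 ∧
    ((eulerNumber (k + 5 + 1) : ℝ) * eulerNumber (k + 5 + 3)
        - (eulerNumber (k + 5 + 2) : ℝ) ^ 2) ^ 2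
      ≤ ((eulerNumber (k + 5) : ℝ) * eulerNumber (k + 5 + 2)
        - (eulerNumber (k + 5 + 1) : ℝ) ^ 2) *
        ((eulerNumber (k + 5 + 2) : ℝ) * eulerNumber (k + 5 + 4)
          - (eulerNumber (k + 5 + 3) : ℝ) ^ 2) := by
  have hN : (5 : ℝ) ≤ ((k + 5 : ℕ) : ℝ) := by push_cast; linarith [Nat.cast_nonneg (α := ℝ) k]
  have b0 := SS_bound (k + 4)
  have b1 := SS_bound (k + 4 + 1)
  have b2 := SS_bound (k + 4 + 2)
  have b3 := SS_bound (k + 4 + 3)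
  have b4 := SS_bound (k + 4 + 4)
  have hK := K_bound k
  obtain ⟨n, hn⟩ : ∃ n, n = k + 5 := ⟨_, rfl⟩
  rw [show k + 4 + 1 = n by omega] at b0
  rw [show k + 4 + 1 + 1 = n + 1 by omega, pow_succ] at b1
  rw [show k + 4 + 2 + 1 = n + 2 by omega, pow_add] at b2
  rw [show k + 4 + 3 + 1 = n + 3 by omega, pow_add] at b3
  rw [show k + 4 + 4 + 1 = n + 4 by omega, pow_add] at b4
  rw [← hn] at hK hN ⊢
  have core := real_core (s1 := SS (n + 1)) (s2 := SS (n + 2)) (s3 := SS (n + 3))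
    (s4 := SS (n + 4)) hN (by positivity) hK b0 (by linarith) (by linarith) (by linarith)
    (by linarith)
  obtain ⟨c1, c2⟩ := core
  set N : ℝ := (n : ℝ)
  set A : ℝ := n.factorial * (4 / Real.pi) * (2 / Real.pi) ^ n with hA
  set r : ℝ := 2 / Real.pi with hr
  have E0 : (eulerNumber n : ℝ) = A * SS n := euler_SS n
  have E1 : (eulerNumber (n + 1) : ℝ) = A * r * (N + 1) * SS (n + 1) := by
    rw [euler_SS, Nat.factorial_succ]; push_cast; rw [hA]; ring
  have E2 : (eulerNumber (n + 2) : ℝ) = A * r ^ 2 * ((N + 1) * (N + 2)) * SS (n + 2) := by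
    rw [euler_SS, Nat.factorial_succ, Nat.factorial_succ]; push_cast; rw [hA]; ring
  have E3 : (eulerNumber (n + 3) : ℝ) =
      A * r ^ 3 * ((N + 1) * (N + 2) * (N + 3)) * SS (n + 3) := by
    rw [euler_SS, Nat.factorial_succ, Nat.factorial_succ, Nat.factorial_succ]
    push_cast; rw [hA]; ring
  have E4 : (eulerNumber (n + 4) : ℝ) =
      A * r ^ 4 * ((N + 1) * (N + 2) * (N + 3) * (N + 4)) * SS (n + 4) := by
    rw [euler_SS, Nat.factorial_succ, Nat.factorial_succ, Nat.factorial_succ, Nat.factorial_succ]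
    push_cast; rw [hA]; ring
  rw [E0, E1, E2, E3, E4]
  constructor
  · have : A * SS n * (A * r ^ 2 * ((N + 1) * (N + 2)) * SS (n + 2))
        - (A * r * (N + 1) * SS (n + 1)) ^ 2 =
        A ^ 2 * r ^ 2 * (N + 1) * ((N + 2) * (SS n * SS (n + 2)) - (N + 1) * SS (n + 1) ^ 2) := by
      ring
    rw [this]
    exact mul_nonneg (mul_nonneg (by positivity) (by linarith)) c1
  · have hM : 0 ≤ A ^ 4 * r ^ 8 * (N + 1) ^ 3 * (N + 2) ^ 2 := by
      have : 0 ≤ N + 1 := by linarith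
      positivity
    have := mul_le_mul_of_nonneg_left c2 hM
    linarith

end EulerAux

/-- the Euler numbers form a `2`-log-convex sequence (from index `1` on):
`Eₙ E_{n+2} ≥ E_{n+1}²` and
`(Eₙ E_{n+2} − E_{n+1}²)(E_{n+2}E_{n+4} − E_{n+3}²) ≥ (E_{n+1}E_{n+3} − E_{n+2}²)²`
for all `n ≥ 1`. -/
theorem eulerNumber_two_log_convex :
    (∀ n : ℕ, 1 ≤ n →
      (eulerNumber (n + 1) : ℤ) ^ 2 ≤ (eulerNumber n : ℤ) * eulerNumber (n + 2)) ∧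
    (∀ n : ℕ, 1 ≤ n →
      ((eulerNumber (n + 1) : ℤ) * eulerNumber (n + 3) - (eulerNumber (n + 2) : ℤ) ^ 2) ^ 2
        ≤ ((eulerNumber n : ℤ) * eulerNumber (n + 2) - (eulerNumber (n + 1) : ℤ) ^ 2) *
          ((eulerNumber (n + 2) : ℤ) * eulerNumber (n + 4) - (eulerNumber (n + 3) : ℤ) ^ 2)) := by
  obtain ⟨v1, v2, v3, v4, v5, v6, v7, v8⟩ := EulerAux.euler_vals
  constructor
  · intro n hn
    by_cases h : n < 5
    · interval_cases n <;> simp [v1, v2, v3, v4, v5, v6]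
    · obtain ⟨k, rfl⟩ : ∃ k, n = k + 5 := ⟨n - 5, by omega⟩
      have := (EulerAux.big_case k).1
      rw [sub_nonneg] at this
      exact_mod_cast this
  · intro n hn
    by_cases h : n < 5
    · interval_cases n <;> simp [v1, v2, v3, v4, v5, v6, v7, v8]
    · obtain ⟨k, rfl⟩ : ∃ k, n = k + 5 := ⟨n - 5, by omega⟩
      have := (EulerAux.big_case k).2
      exact_mod_cast this
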